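/- Axis Lemma: Let σ be a turn sequence that is not a staircase (i.e., σ contains at least one pair of equal consecutive turns). If a point (a,b) is reachable by σ, then at least one of the points (0,b) and (a,0) is reachable by σ. -/

import Mathlib

/-- A turn: left (`L`) or right (`R`). -/
inductive Turn : Type
  | L : Turn
  | R : Turn
  deriving DecidableEq

/-- Rotation of a direction vector by 90° counterclockwise. -/
def rotCCW (d : ℤ × ℤ) : ℤ × ℤ := (-d.2, d.1)

/-- Rotation of a direction vector by 90° clockwise. -/
def rotCW (d : ℤ × ℤ) : ℤ × ℤ := (d.2, -d.1)

/-- Unit direction of the axis-parallel segment from `u` to `v`. -/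
def unitDir (u v : ℤ × ℤ) : ℤ × ℤ := ((v.1 - u.1).sign, (v.2 - u.2).sign)

/-- The set of integer points on the axis-parallel closed segment from `u` to `v`. -/
def segSet (u v : ℤ × ℤ) : Set (ℤ × ℤ) :=
  {q | min u.1 v.1 ≤ q.1 ∧ q.1 ≤ max u.1 v.1 ∧ min u.2 v.2 ≤ q.2 ∧ q.2 ≤ max u.2 v.2}

/-- A simple rectilinear chain realizing the turn sequence `σ = σ₁⋯σₙ` (as a list,
`σ.get ⟨i, _⟩` is the `(i+1)`-st turn `σ_{i+1}`).  It consists of the points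
`pts 0, …, pts (n+1)` with `pts 0 = (0,0)`; consecutive points span nondegenerate
axis-parallel segments, the first segment heads east, the chain turns left (CCW) or
right (CW) at each bend as prescribed by `σ`, and the chain is simple. -/
structure Chain (σ : List Turn) where
  pts : ℕ → ℤ × ℤ
  start_eq : pts 0 = (0, 0)
  first_seg : ∃ t : ℤ, 0 < t ∧ pts 1 = (t, 0)
  axis_parallel : ∀ i ≤ σ.length,
    ((pts (i + 1)).1 = (pts i).1 ∧ (pts (i + 1)).2 ≠ (pts i).2) ∨
    ((pts (i + 1)).2 = (pts i).2 ∧ (pts (i + 1)).1 ≠ (pts i).1)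
  turns : ∀ i, ∀ h : i < σ.length,
    unitDir (pts (i + 1)) (pts (i + 2)) =
      (if σ.get ⟨i, h⟩ = Turn.L then rotCCW else rotCW) (unitDir (pts i) (pts (i + 1)))
  simple_adj : ∀ i, i + 1 ≤ σ.length →
    segSet (pts i) (pts (i + 1)) ∩ segSet (pts (i + 1)) (pts (i + 2)) = {pts (i + 1)}
  simple_nonadj : ∀ i j, i + 1 < j → j ≤ σ.length →
    segSet (pts i) (pts (i + 1)) ∩ segSet (pts j) (pts (j + 1)) = ∅

/-- `A(σ)`: the set of points reachable by the turn sequence `σ`. -/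
def ReachSet (σ : List Turn) : Set (ℤ × ℤ) :=
  {q | ∃ C : Chain σ, C.pts (σ.length + 1) = q}

/-- The halfplane `V⁺(p)` (requires `p.1 ≠ 0` to be meaningful). -/
def Vplus (p : ℤ × ℤ) : Set (ℤ × ℤ) :=
  {q | ∃ i j : ℤ, 0 ≤ i ∧ q = (p.1 + p.1.sign * i, j)}

/-- The halfplane `H⁺(p)` (requires `p.2 ≠ 0` to be meaningful). -/
def Hplus (p : ℤ × ℤ) : Set (ℤ × ℤ) :=
  {q | ∃ i j : ℤ, 0 ≤ j ∧ q = (i, p.2 + p.2.sign * j)}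

/-- The quadrant `Q⁺(p)`. -/
def Qplus (p : ℤ × ℤ) : Set (ℤ × ℤ) := Vplus p ∩ Hplus p

/-- A staircase: consecutive turns always differ. -/
def IsStaircase (σ : List Turn) : Prop := σ.Chain' (· ≠ ·)

/-- The prefix number `δᵢ`: number of `L`s minus number of `R`s among the first `i` turns. -/
def delta (σ : List Turn) (i : ℕ) : ℤ :=
  ((σ.take i).count Turn.L : ℤ) - ((σ.take i).count Turn.R : ℤ)

/-- The excess number `l - r` of a turn sequence. -/
def excess (σ : List Turn) : ℤ := (σ.count Turn.L : ℤ) - (σ.count Turn.R : ℤ)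

/-- `σ` has a hook (two equal consecutive turns, at 1-based positions `k+1, k+2`)
whose prefix number is `≡ d (mod 4)`: `d = 0, 1, 2, 3` for right, up, left, down hooks. -/
def HasHook (σ : List Turn) (d : ℤ) : Prop :=
  ∃ k, ∃ h : k + 1 < σ.length,
    σ.get ⟨k, by omega⟩ = σ.get ⟨k + 1, h⟩ ∧ delta σ (k + 1) % 4 = d

/-- `σ` has some hook, i.e. two equal consecutive turns. -/
def HasAnyHook (σ : List Turn) : Prop :=
  ∃ k, ∃ h : k + 1 < σ.length, σ.get ⟨k, by omega⟩ = σ.get ⟨k + 1, h⟩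

/-- A set `S ⊆ ℤ²` is connected: any two points of `S` are joined by a path inside `S`
whose consecutive points are at `L¹`-distance `1`. -/
def GridConnected (S : Set (ℤ × ℤ)) : Prop :=
  ∀ p ∈ S, ∀ q ∈ S, ∃ (n : ℕ) (f : ℕ → ℤ × ℤ),
    f 0 = p ∧ f n = q ∧ (∀ i ≤ n, f i ∈ S) ∧
    ∀ i < n, |(f (i + 1)).1 - (f i).1| + |(f (i + 1)).2 - (f i).2| = 1

/-- `q` lies on the boundary of the smallest axis-parallel bounding box of the chain `C`
(for `q` a point of the chain: it attains an extreme coordinate). -/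
def OnBBoxBoundary (σ : List Turn) (C : Chain σ) (q : ℤ × ℤ) : Prop :=
  (∀ i ≤ σ.length + 1, q.1 ≤ (C.pts i).1) ∨ (∀ i ≤ σ.length + 1, (C.pts i).1 ≤ q.1) ∨
  (∀ i ≤ σ.length + 1, q.2 ≤ (C.pts i).2) ∨ (∀ i ≤ σ.length + 1, (C.pts i).2 ≤ q.2)

/-- The last segment of the chain `C` is entirely contained in one side of the smallest
axis-parallel bounding box of `C`. -/
def LastSegOnSide (σ : List Turn) (C : Chain σ) : Prop :=
  ((C.pts σ.length).1 = (C.pts (σ.length + 1)).1 ∧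
     ∀ i ≤ σ.length + 1, (C.pts σ.length).1 ≤ (C.pts i).1) ∨
  ((C.pts σ.length).1 = (C.pts (σ.length + 1)).1 ∧
     ∀ i ≤ σ.length + 1, (C.pts i).1 ≤ (C.pts σ.length).1) ∨
  ((C.pts σ.length).2 = (C.pts (σ.length + 1)).2 ∧
     ∀ i ≤ σ.length + 1, (C.pts σ.length).2 ≤ (C.pts i).2) ∨
  ((C.pts σ.length).2 = (C.pts (σ.length + 1)).2 ∧
     ∀ i ≤ σ.length + 1, (C.pts i).2 ≤ (C.pts σ.length).2)

/-- The turn `σₘ` (1-based indexing). -/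
def turnAt (σ : List Turn) (m : ℕ) : Turn := σ.getD (m - 1) Turn.L

/-- The suffix `σ_k ⋯ σ_n` contains no hook and all its prefix numbers `δᵢ`,
`k - 1 ≤ i ≤ n`, are `≡ 1` or `2 (mod 4)` (the combinatorial description of a
NW-staircase containing the endpoint). -/
def GoodSuffix (σ : List Turn) (k : ℕ) : Prop :=
  1 ≤ k ∧ k ≤ σ.length ∧
  (∀ m : ℕ, k ≤ m → m < σ.length → turnAt σ m ≠ turnAt σ (m + 1)) ∧
  (∀ i : ℕ, k - 1 ≤ i → i ≤ σ.length → delta σ i % 4 = 1 ∨ delta σ i % 4 = 2)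

open Classical in
/-- `₋ₓm₊ᵧᵖ(σ)`: taking the longest good suffix (i.e. the least `k` with
`GoodSuffix σ k`), the number of indices `i` with `k - 1 ≤ i ≤ n` and
`δᵢ ≡ 1 (mod 4)`; `0` if no good suffix exists. -/
noncomputable def mNWp (σ : List Turn) : ℕ :=
  if ∃ k, GoodSuffix σ k then
    Nat.card {i : ℕ // sInf {k | GoodSuffix σ k} - 1 ≤ i ∧ i ≤ σ.length ∧
      delta σ i % 4 = 1}
  else 0

/-- The number of vertical segments of the chain `C` meeting the closed horizontal
segment from the origin to `(a, 0)`. -/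
def verticalCrossCount (σ : List Turn) (C : Chain σ) (a : ℤ) : ℕ :=
  ((Finset.range (σ.length + 1)).filter fun i =>
    (C.pts i).1 = (C.pts (i + 1)).1 ∧
    0 ≤ (C.pts i).1 ∧ (C.pts i).1 ≤ a ∧
    min (C.pts i).2 (C.pts (i + 1)).2 ≤ 0 ∧ 0 ≤ max (C.pts i).2 (C.pts (i + 1)).2).card

/-- The unit direction of the `(i+1)`-st segment of the chain `C`. -/
def dirOf (σ : List Turn) (C : Chain σ) (i : ℕ) : ℤ × ℤ := unitDir (C.pts i) (C.pts (i + 1))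

/-- `z₁mz₂ᵒ(C)`: the number of `z₂`-segments in the maximal `(z₁,z₂)`-staircase subchain
of `C` containing the origin (the longest prefix of segments directed `z₁` or `z₂`);
`0` if no such subchain exists. -/
noncomputable def stairCountO (σ : List Turn) (C : Chain σ) (z₁ z₂ : ℤ × ℤ) : ℕ :=
  Nat.card {i : ℕ // i ≤ σ.length ∧ dirOf σ C i = z₂ ∧
    ∀ j ≤ i, dirOf σ C j = z₁ ∨ dirOf σ C j = z₂}

/-- `z₁mz₂ᵖ(C)`: the number of `z₂`-segments in the maximal `(z₁,z₂)`-staircase subchain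
of `C` containing the endpoint (the longest suffix of segments directed `z₁` or `z₂`);
`0` if no such subchain exists. -/
noncomputable def stairCountP (σ : List Turn) (C : Chain σ) (z₁ z₂ : ℤ × ℤ) : ℕ :=
  Nat.card {i : ℕ // i ≤ σ.length ∧ dirOf σ C i = z₂ ∧
    ∀ j, i ≤ j → j ≤ σ.length → dirOf σ C j = z₁ ∨ dirOf σ C j = z₂}

/-- The grid steps that go up freely, and sideways only along the horizontal unit edges in `H`
(`H q` says that the edge from `q` to its right neighbour is present). -/
def UpStep (H : ℤ × ℤ → Prop) (q r : ℤ × ℤ) : Prop :=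
  r = (q.1, q.2 + 1) ∨ (r = (q.1 + 1, q.2) ∧ H q) ∨ (q = (r.1 + 1, r.2) ∧ H r)

/-- The grid steps that go right freely, and up or down only along the vertical unit edges in `V`
(`V q` says that the edge from `q` to its upper neighbour is present). -/
def RightStep (V : ℤ × ℤ → Prop) (q r : ℤ × ℤ) : Prop :=
  r = (q.1 + 1, q.2) ∨ (r = (q.1, q.2 + 1) ∧ V q) ∨ (q = (r.1, r.2 + 1) ∧ V r)

/-- The grid steps that go right or up along present edges. -/
def NEStep (H V : ℤ × ℤ → Prop) (q r : ℤ × ℤ) : Prop :=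
  (r = (q.1 + 1, q.2) ∧ H q) ∨ (r = (q.1, q.2 + 1) ∧ V q)

open Relation

theorem UpStep.le {H : ℤ × ℤ → Prop} {u v : ℤ × ℤ} (h : ReflTransGen (UpStep H) u v) :
    u.2 ≤ v.2 := by
  induction h with
  | refl => exact le_rfl
  | tail _ h ih => rcases h with rfl | ⟨rfl, _⟩ | ⟨rfl, _⟩ <;> simp at * <;> omega

theorem RightStep.le {V : ℤ × ℤ → Prop} {u v : ℤ × ℤ} (h : ReflTransGen (RightStep V) u v) :
    u.1 ≤ v.1 := by
  induction h with
  | refl => exact le_rfl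
  | tail _ h ih => rcases h with rfl | ⟨rfl, _⟩ | ⟨rfl, _⟩ <;> simp at * <;> omega

theorem RightStep.swap {H : ℤ × ℤ → Prop} {u v : ℤ × ℤ} (h : ReflTransGen (UpStep H) u v) :
    ReflTransGen (RightStep fun q => H q.swap) u.swap v.swap := by
  induction h with
  | refl => exact .refl
  | tail _ h ih =>
    refine ih.tail ?_
    rcases h with rfl | ⟨rfl, h⟩ | ⟨rfl, h⟩
    · exact .inl rfl
    · exact .inr (.inl ⟨rfl, h⟩)
    · exact .inr (.inr ⟨rfl, h⟩)

/-- The trace of a path of right steps: it passes from each column to the next, and within a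
column it is an interval of present edges. -/
theorem RightStep.exists_trace {V : ℤ × ℤ → Prop} {u v : ℤ × ℤ}
    (h : ReflTransGen (RightStep V) u v) :
    ∃ T : Set (ℤ × ℤ), u ∈ T ∧ v ∈ T ∧
      (∀ z ∈ T, ReflTransGen (RightStep V) u z ∧ ReflTransGen (RightStep V) z v) ∧
      (∀ x, u.1 ≤ x → x < v.1 → ∃ y, (x, y) ∈ T ∧ (x + 1, y) ∈ T) ∧
      (∀ x y₁ y₂ y, (x, y₁) ∈ T → (x, y₂) ∈ T → y₁ ≤ y → y < y₂ → V (x, y) ∧ (x, y) ∈ T) := by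
  induction h with
  | refl =>
    refine ⟨{u}, rfl, rfl, ?_, ?_, ?_⟩
    · rintro z rfl
      exact ⟨.refl, .refl⟩
    · intro x h₁ h₂
      omega
    · rintro x y₁ y₂ y h₁ h₂ h₃ h₄
      have := congrArg Prod.snd h₁
      have := congrArg Prod.snd h₂
      simp at *
      omega
  | @tail w v hw h ih =>
    obtain ⟨T, hu, hwT, hT, hcol, hint⟩ := ih
    have huw := RightStep.le hw
    refine ⟨insert v T, .inr hu, .inl rfl, ?_, ?_, ?_⟩
    · rintro z (rfl | hz)
      · exact ⟨hw.tail h, .refl⟩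
      · exact ⟨(hT z hz).1, (hT z hz).2.tail h⟩
    · intro x h₁ h₂
      by_cases hx : x < w.1
      · obtain ⟨y, hy, hy'⟩ := hcol x h₁ hx
        exact ⟨y, .inr hy, .inr hy'⟩
      · rcases h with rfl | ⟨rfl, _⟩ | ⟨rfl, _⟩
        · obtain rfl : x = w.1 := by simp at *; omega
          exact ⟨w.2, .inr hwT, .inl rfl⟩
        · simp at *; omega
        · simp at *; omega
    · intro x y₁ y₂ y h₁ h₂ h₃ h₄
      have hle : ∀ z ∈ T, z.1 ≤ w.1 := fun z hz => RightStep.le (hT z hz).2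
      rcases h₁ with h₁ | h₁ <;> rcases h₂ with h₂ | h₂
      · rw [← h₂, Prod.mk.injEq] at h₁
        omega
      · subst h₁
        have hx := hle _ h₂
        rcases h with h | ⟨h, hV⟩ | ⟨rfl, hV⟩
        · have := congrArg Prod.fst h
          simp at *; omega
        · obtain ⟨w1, w2⟩ := w
          rw [Prod.mk.injEq] at h
          obtain ⟨rfl, rfl⟩ := h
          exact (hint _ _ _ _ hwT h₂ (by simp at *; omega) h₄).imp_right .inr
        · rcases h₃.eq_or_lt with rfl | h₃
          · exact ⟨hV, .inl rfl⟩
          · exact (hint _ _ _ _ hwT h₂ (by simp at *; omega) h₄).imp_right .inr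
      · subst h₂
        have hx := hle _ h₁
        rcases h with h | ⟨h, hV⟩ | ⟨rfl, hV⟩
        · have := congrArg Prod.fst h
          simp at *; omega
        · obtain ⟨w1, w2⟩ := w
          rw [Prod.mk.injEq] at h
          obtain ⟨rfl, rfl⟩ := h
          rcases (show y ≤ w2 by simp at *; omega).eq_or_lt with rfl | h₄
          · exact ⟨hV, .inr hwT⟩
          · exact (hint _ _ _ _ h₁ hwT h₃ h₄).imp_right .inr
        · exact (hint _ _ _ _ h₁ hwT h₃ (by simp at *; omega)).imp_right .inr
      · exact (hint _ _ _ _ h₁ h₂ h₃ h₄).imp_right .inr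

/-- A path of right steps and a path of up steps between the same two points meet in between. -/
theorem exists_meeting_point {H V : ℤ × ℤ → Prop} {u v : ℤ × ℤ}
    (hX : ReflTransGen (RightStep V) u v) (hY : ReflTransGen (UpStep H) u v)
    (h₁ : u.1 < v.1) (h₂ : u.2 < v.2) (hu : ¬ (H u ∧ V u))
    (hv : ¬ (H (v.1 - 1, v.2) ∧ V (v.1, v.2 - 1))) :
    ∃ z, z ≠ u ∧ z ≠ v ∧ ReflTransGen (RightStep V) u z ∧ ReflTransGen (RightStep V) z v ∧
      ReflTransGen (UpStep H) u z ∧ ReflTransGen (UpStep H) z v := by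
  by_contra hno
  obtain ⟨T, huT, hvT, hT, hcol, hint⟩ := RightStep.exists_trace hX
  have key : ∀ q, ReflTransGen (UpStep H) u q → ReflTransGen (UpStep H) q v →
      q = u ∨ (q.1 ≤ v.1 ∧ (u.1 ≤ q.1 → ∀ y, (q.1, y) ∈ T → y < q.2)) := by
    intro q hq
    induction hq with
    | refl => exact fun _ => .inl rfl
    | @tail q r hq h ih =>
      intro hrv
      have hmeet : r ∈ T → r = u ∨ r = v := by
        intro hr
        by_contra hc
        push Not at hc
        exact hno ⟨r, hc.1, hc.2, (hT r hr).1, (hT r hr).2, hq.tail h, hrv⟩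
      have hqy := UpStep.le hq
      have hry := UpStep.le hrv
      have hq' := ih (.head h hrv)
      by_cases hru : r = u
      · exact .inl hru
      refine .inr ?_
      have hbtw : ∀ {x y y₁ y₂}, (x, y₁) ∈ T → (x, y₂) ∈ T → y₁ ≤ y → y ≤ y₂ → (x, y) ∈ T := by
        intro x y y₁ y₂ hy₁ hy₂ h h'
        rcases h'.eq_or_lt with rfl | h'
        · exact hy₂
        · exact (hint _ _ _ _ hy₁ hy₂ h h').2
      obtain ⟨u1, u2⟩ := u
      obtain ⟨v1, v2⟩ := v
      obtain ⟨q1, q2⟩ := q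
      obtain ⟨r1, r2⟩ := r
      simp only [Prod.mk.injEq] at *
      have habove : (u1 ≤ r1 → r1 ≤ v1) → (u1 ≤ r1 → ∃ y ≤ r2, (r1, y) ∈ T) →
          ((r1, r2) ∈ T → u1 ≤ r1 → False) →
          r1 ≤ v1 ∧ (u1 ≤ r1 → ∀ y, (r1, y) ∈ T → y < r2) := by
        intro k₁ k₂ k₃
        refine ⟨by omega, fun hx y hy => ?_⟩
        by_contra hlt
        obtain ⟨y', hy', hyT⟩ := k₂ hx
        exact k₃ (hbtw hyT hy hy' (by omega)) hx
      rcases hq' with ⟨rfl, rfl⟩ | ⟨hqv, hqT⟩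
      · rcases h with ⟨rfl, rfl⟩ | ⟨⟨rfl, rfl⟩, hH⟩ | ⟨⟨rfl, rfl⟩, hH⟩
        · exact habove (by omega) (fun _ => ⟨_, by omega, huT⟩) (fun hr _ => by
            rcases hmeet hr with h | h <;> omega)
        · obtain ⟨y, hy, hy'⟩ := hcol q1 le_rfl h₁
          have hyq : y ≤ q2 := by
            by_contra hlt
            exact hu ⟨hH, (hint _ _ _ _ huT hy le_rfl (by omega)).1⟩
          exact habove (by omega) (fun _ => ⟨y, hyq, hy'⟩) (fun hr _ => by
            rcases hmeet hr with h | h <;> omega)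
        · exact habove (by omega) (by omega) (by omega)
      · rcases h with ⟨rfl, rfl⟩ | ⟨⟨rfl, rfl⟩, hH⟩ | ⟨⟨rfl, rfl⟩, hH⟩
        · exact ⟨hqv, fun hx y hy => (hqT hx y hy).trans (by omega)⟩
        · have hqlt : u1 ≤ q1 → q1 < v1 := by
            intro hx
            by_contra hlt
            obtain rfl : q1 = v1 := by omega
            have := hqT hx _ hvT
            omega
          refine habove (by omega) (fun hx => ?_) (fun hr hx => ?_)
          · rcases hx.eq_or_lt with rfl | hx
            · exact ⟨u2, hqy, huT⟩
            · obtain ⟨y, hy, hy'⟩ := hcol q1 (by omega) (hqlt (by omega))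
              exact ⟨y, (hqT (by omega) y hy).le, hy'⟩
          · obtain ⟨rfl, rfl⟩ := (hmeet hr).resolve_left hru
            obtain ⟨y, hy, hy'⟩ := hcol q1 (by omega) (by omega)
            have hlt := hqT (by omega) y hy
            have := (hint _ _ _ (q2 - 1) hy' hvT (by omega) (by omega)).1
            exact hv ⟨by simpa using hH, this⟩
        · refine habove (by omega) (fun hx => ?_) (fun hr hx => ?_)
          · obtain ⟨y, hy, hy'⟩ := hcol r1 hx (by omega)
            exact ⟨y, (hqT (by omega) y hy').le, hy⟩
          · rcases hmeet hr with h | h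
            · exact hru h
            · omega
  rcases key v hY .refl with h | ⟨-, h⟩
  · rw [h] at h₁
    omega
  · exact lt_irrefl _ (h h₁.le v.2 hvT)

theorem RightStep.vertical {V : ℤ × ℤ → Prop} {x a b : ℤ}
    (h : ReflTransGen (RightStep V) (x, a) (x, b)) {y : ℤ} (h₁ : a ≤ y) (h₂ : y < b) :
    V (x, y) := by
  obtain ⟨T, hu, hv, -, -, hint⟩ := RightStep.exists_trace h
  exact (hint _ _ _ _ hu hv h₁ h₂).1

theorem NEStep.vertical (H : ℤ × ℤ → Prop) {V : ℤ × ℤ → Prop} {x a b : ℤ} (hab : a ≤ b)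
    (h : ∀ y, a ≤ y → y < b → V (x, y)) : ReflTransGen (NEStep H V) (x, a) (x, b) := by
  induction b, hab using Int.leInduction with
  | base => exact .refl
  | succ b hb ih =>
    exact (ih fun y h₁ h₂ => h y h₁ (by omega)).tail (.inr ⟨rfl, h b hb (by omega)⟩)

theorem NEStep.horizontal {H : ℤ × ℤ → Prop} (V : ℤ × ℤ → Prop) {a b y : ℤ} (hab : a ≤ b)
    (h : ∀ x, a ≤ x → x < b → H (x, y)) : ReflTransGen (NEStep H V) (a, y) (b, y) := by
  induction b, hab using Int.leInduction with
  | base => exact .refl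
  | succ b hb ih =>
    exact (ih fun x h₁ h₂ => h x h₁ (by omega)).tail (.inl ⟨rfl, h b hb (by omega)⟩)

/-- Let no vertex that is left rightwards and upwards be entered from the left or from below, and
no vertex that is entered from the left and from below be left rightwards or upwards. Then a path
of right steps and a path of up steps between the same points yield a monotone path. -/
theorem reflTransGen_neStep {H V : ℤ × ℤ → Prop}
    (hd₁ : ∀ x y, H (x, y) → V (x, y) → ¬ H (x - 1, y) ∧ ¬ V (x, y - 1))
    (hd₂ : ∀ x y, H (x - 1, y) → V (x, y - 1) → ¬ H (x, y) ∧ ¬ V (x, y)) {u v : ℤ × ℤ}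
    (hX : ReflTransGen (RightStep V) u v) (hY : ReflTransGen (UpStep H) u v)
    (hu : ¬ (H u ∧ V u)) (hv : ¬ (H (v.1 - 1, v.2) ∧ V (v.1, v.2 - 1))) :
    ReflTransGen (NEStep H V) u v := by
  obtain ⟨k, hk⟩ : ∃ k : ℕ, (v.1 - u.1) + (v.2 - u.2) ≤ k := ⟨_, Int.self_le_toNat _⟩
  induction k using Nat.strong_induction_on generalizing u v with
  | _ k ih =>
  have hx := RightStep.le hX
  have hy := UpStep.le hY
  rcases hx.eq_or_lt with hx | hx
  · obtain ⟨u1, u2⟩ := u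
    obtain ⟨v1, v2⟩ := v
    obtain rfl : u1 = v1 := hx
    exact NEStep.vertical H hy fun y h₁ h₂ => RightStep.vertical hX h₁ h₂
  rcases hy.eq_or_lt with hy | hy
  · have hY' := RightStep.swap hY
    obtain ⟨u1, u2⟩ := u
    obtain ⟨v1, v2⟩ := v
    obtain rfl : u2 = v2 := hy
    exact NEStep.horizontal V hx.le fun x h₁ h₂ => RightStep.vertical hY' h₁ h₂
  obtain ⟨z, hzu, hzv, hXu, hXv, hYu, hYv⟩ := exists_meeting_point hX hY hx hy hu hv
  have hx₁ := RightStep.le hXu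
  have hx₂ := RightStep.le hXv
  have hy₁ := UpStep.le hYu
  have hy₂ := UpStep.le hYv
  have hzu' : z.1 ≠ u.1 ∨ z.2 ≠ u.2 := by
    by_contra! hc
    exact hzu (Prod.ext hc.1 hc.2)
  have hzv' : z.1 ≠ v.1 ∨ z.2 ≠ v.2 := by
    by_contra! hc
    exact hzv (Prod.ext hc.1 hc.2)
  have ih₁ (h : ¬ (H (z.1 - 1, z.2) ∧ V (z.1, z.2 - 1))) : ReflTransGen (NEStep H V) u z :=
    ih (k - 1) (by omega) hXu hYu hu h (by omega)
  have ih₂ (h : ¬ (H z ∧ V z)) : ReflTransGen (NEStep H V) z v :=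
    ih (k - 1) (by omega) hXv hYv h hv (by omega)
  by_cases h₁ : H z ∧ V z
  · have hd := hd₁ _ _ h₁.1 h₁.2
    exfalso
    rcases ReflTransGen.cases_tail (ih₁ fun h => hd.1 h.1) with h | ⟨w, -, h⟩
    · exact hzu h
    · rcases h with ⟨rfl, h⟩ | ⟨rfl, h⟩
      · exact hd.1 (by simpa using h)
      · exact hd.2 (by simpa using h)
  by_cases h₂ : H (z.1 - 1, z.2) ∧ V (z.1, z.2 - 1)
  · have hd := hd₂ _ _ h₂.1 h₂.2
    exfalso
    rcases ReflTransGen.cases_head (ih₂ h₁) with h | ⟨w, h, -⟩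
    · exact hzv h
    · rcases h with ⟨-, h⟩ | ⟨-, h⟩
      · exact hd.1 h
      · exact hd.2 h
  exact (ih₁ h₂).trans (ih₂ h₁)

/-- A simple rectilinear arc with segments `P i`, `P (i + 1)` for `i ≤ n`. -/
structure SimpleArc (n : ℕ) (P : ℕ → ℤ × ℤ) : Prop where
  axis : ∀ i ≤ n, ((P (i + 1)).1 = (P i).1 ∧ (P (i + 1)).2 ≠ (P i).2) ∨
    ((P (i + 1)).2 = (P i).2 ∧ (P (i + 1)).1 ≠ (P i).1)
  adj : ∀ i, i + 1 ≤ n →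
    segSet (P i) (P (i + 1)) ∩ segSet (P (i + 1)) (P (i + 2)) = {P (i + 1)}
  nonadj : ∀ i j, i + 1 < j → j ≤ n →
    segSet (P i) (P (i + 1)) ∩ segSet (P j) (P (j + 1)) = ∅

/-- The edge from `q` to its right neighbour lies on the arc. -/
def HEdge (n : ℕ) (P : ℕ → ℤ × ℤ) (q : ℤ × ℤ) : Prop :=
  ∃ i ≤ n, q ∈ segSet (P i) (P (i + 1)) ∧ (q.1 + 1, q.2) ∈ segSet (P i) (P (i + 1))

/-- The edge from `q` to its upper neighbour lies on the arc. -/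
def VEdge (n : ℕ) (P : ℕ → ℤ × ℤ) (q : ℤ × ℤ) : Prop :=
  ∃ i ≤ n, q ∈ segSet (P i) (P (i + 1)) ∧ (q.1, q.2 + 1) ∈ segSet (P i) (P (i + 1))

theorem mem_segSet {u v q : ℤ × ℤ} : q ∈ segSet u v ↔
    min u.1 v.1 ≤ q.1 ∧ q.1 ≤ max u.1 v.1 ∧ min u.2 v.2 ≤ q.2 ∧ q.2 ≤ max u.2 v.2 :=
  Iff.rfl

theorem left_mem_segSet (u v : ℤ × ℤ) : u ∈ segSet u v := by
  rw [mem_segSet]; omega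

theorem right_mem_segSet (u v : ℤ × ℤ) : v ∈ segSet u v := by
  rw [mem_segSet]; omega

namespace SimpleArc

variable {n : ℕ} {P : ℕ → ℤ × ℤ}

theorem eq_of_mem_of_lt (hP : SimpleArc n P) {i j : ℕ} {q : ℤ × ℤ} (hij : i < j) (hj : j ≤ n)
    (hqi : q ∈ segSet (P i) (P (i + 1))) (hqj : q ∈ segSet (P j) (P (j + 1))) :
    j = i + 1 ∧ q = P j := by
  rcases (show i + 1 ≤ j from hij).eq_or_lt with rfl | h
  · have : q ∈ segSet (P i) (P (i + 1)) ∩ segSet (P (i + 1)) (P (i + 2)) := ⟨hqi, hqj⟩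
    rw [hP.adj i hj] at this
    exact ⟨rfl, this⟩
  · have : q ∈ segSet (P i) (P (i + 1)) ∩ segSet (P j) (P (j + 1)) := ⟨hqi, hqj⟩
    rw [hP.nonadj i j h hj] at this
    exact this.elim

theorem ne_succ (hP : SimpleArc n P) {i : ℕ} (hi : i ≤ n) : P (i + 1) ≠ P i := by
  intro h
  have := hP.axis i hi
  rw [h] at this
  omega

theorem eq_zero_of_start_mem (hP : SimpleArc n P) {i : ℕ} (hi : i ≤ n)
    (h : P 0 ∈ segSet (P i) (P (i + 1))) : i = 0 := by
  by_contra hc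
  obtain ⟨rfl, h'⟩ := hP.eq_of_mem_of_lt (Nat.pos_of_ne_zero hc) hi (left_mem_segSet _ _) h
  exact hP.ne_succ (Nat.zero_le n) h'.symm

theorem eq_of_end_mem (hP : SimpleArc n P) {i : ℕ} (hi : i ≤ n)
    (h : P (n + 1) ∈ segSet (P i) (P (i + 1))) : i = n := by
  by_contra hc
  obtain ⟨-, h'⟩ := hP.eq_of_mem_of_lt (by omega) le_rfl h (right_mem_segSet _ _)
  exact hP.ne_succ le_rfl h'

theorem snd_eq_of_mem (hP : SimpleArc n P) {i : ℕ} {q r : ℤ × ℤ} (hi : i ≤ n)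
    (hq : q ∈ segSet (P i) (P (i + 1))) (hr : r ∈ segSet (P i) (P (i + 1))) (h : q.1 ≠ r.1) :
    (P (i + 1)).2 = (P i).2 := by
  have := hP.axis i hi
  rw [mem_segSet] at hq hr
  omega

theorem fst_eq_of_mem (hP : SimpleArc n P) {i : ℕ} {q r : ℤ × ℤ} (hi : i ≤ n)
    (hq : q ∈ segSet (P i) (P (i + 1))) (hr : r ∈ segSet (P i) (P (i + 1))) (h : q.2 ≠ r.2) :
    (P (i + 1)).1 = (P i).1 := by
  have := hP.axis i hi
  rw [mem_segSet] at hq hr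
  omega

/-- The segments carrying a horizontal and a vertical edge at a common vertex are consecutive. -/
theorem corner (hP : SimpleArc n P) {i j : ℕ} {q r s : ℤ × ℤ} (hi : i ≤ n) (hj : j ≤ n)
    (hqi : q ∈ segSet (P i) (P (i + 1))) (hr : r ∈ segSet (P i) (P (i + 1))) (hqr : q.1 ≠ r.1)
    (hqj : q ∈ segSet (P j) (P (j + 1))) (hs : s ∈ segSet (P j) (P (j + 1))) (hqs : q.2 ≠ s.2) :
    (j = i + 1 ∧ q = P j) ∨ (i = j + 1 ∧ q = P i) := by
  rcases lt_trichotomy i j with h | rfl | h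
  · exact .inl (hP.eq_of_mem_of_lt h hj hqi hqj)
  · have h₁ := hP.snd_eq_of_mem hi hqi hr hqr
    have h₂ := hP.fst_eq_of_mem hi hqi hs hqs
    exact absurd (Prod.ext h₂ h₁) (hP.ne_succ hi)
  · exact .inr (hP.eq_of_mem_of_lt h hi hqj hqi)

theorem no_horizontal_tee (hP : SimpleArc n P) {i j k : ℕ} {q r s t : ℤ × ℤ}
    (hi : i ≤ n) (hj : j ≤ n) (hk : k ≤ n)
    (hqi : q ∈ segSet (P i) (P (i + 1))) (hr : r ∈ segSet (P i) (P (i + 1))) (hqr : q.1 < r.1)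
    (hqk : q ∈ segSet (P k) (P (k + 1))) (ht : t ∈ segSet (P k) (P (k + 1))) (hqt : t.1 < q.1)
    (hqj : q ∈ segSet (P j) (P (j + 1))) (hs : s ∈ segSet (P j) (P (j + 1))) (hqs : q.2 ≠ s.2) :
    False := by
  have hend : ∀ m, (q = P m ∨ q = P (m + 1)) → r ∈ segSet (P m) (P (m + 1)) →
      t ∈ segSet (P m) (P (m + 1)) → False := by
    rintro m (rfl | rfl) hr ht <;> rw [mem_segSet] at hr ht <;> omega
  rcases hP.corner hi hj hqi hr hqr.ne hqj hs hqs with ⟨rfl, h₁⟩ | ⟨rfl, h₁⟩ <;>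
    rcases hP.corner hk hj hqk ht hqt.ne' hqj hs hqs with ⟨h, h₂⟩ | ⟨rfl, h₂⟩
  · obtain rfl : i = k := by omega
    exact hend i (.inr h₁) hr ht
  · exact hP.ne_succ hj (h₂.symm.trans h₁)
  · subst h
    exact hP.ne_succ hj (h₁.symm.trans h₂)
  · exact hend _ (.inl h₁) hr ht

theorem no_vertical_tee (hP : SimpleArc n P) {i j k : ℕ} {q r s t : ℤ × ℤ}
    (hi : i ≤ n) (hj : j ≤ n) (hk : k ≤ n)
    (hqi : q ∈ segSet (P i) (P (i + 1))) (hr : r ∈ segSet (P i) (P (i + 1))) (hqr : q.2 < r.2)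
    (hqk : q ∈ segSet (P k) (P (k + 1))) (ht : t ∈ segSet (P k) (P (k + 1))) (hqt : t.2 < q.2)
    (hqj : q ∈ segSet (P j) (P (j + 1))) (hs : s ∈ segSet (P j) (P (j + 1))) (hqs : q.1 ≠ s.1) :
    False := by
  have hend : ∀ m, (q = P m ∨ q = P (m + 1)) → r ∈ segSet (P m) (P (m + 1)) →
      t ∈ segSet (P m) (P (m + 1)) → False := by
    rintro m (rfl | rfl) hr ht <;> rw [mem_segSet] at hr ht <;> omega
  rcases hP.corner hj hi hqj hs hqs hqi hr hqr.ne with ⟨rfl, h₁⟩ | ⟨rfl, h₁⟩ <;>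
    rcases hP.corner hj hk hqj hs hqs hqk ht hqt.ne' with ⟨h, h₂⟩ | ⟨h, h₂⟩
  · subst h
    exact hend _ (.inl h₁) hr ht
  · subst h
    exact hP.ne_succ hj (h₁.symm.trans h₂)
  · subst h
    exact hP.ne_succ hj (h₂.symm.trans h₁)
  · obtain rfl : i = k := by omega
    exact hend i (.inr h₁) hr ht

theorem not_edge_of_ne_corner (hP : SimpleArc n P) (x y : ℤ) (hH : HEdge n P (x, y))
    (hV : VEdge n P (x, y)) :
    ¬ HEdge n P (x - 1, y) ∧ ¬ VEdge n P (x, y - 1) := by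
  obtain ⟨i, hi, hi₁, hi₂⟩ := hH
  obtain ⟨j, hj, hj₁, hj₂⟩ := hV
  constructor <;> rintro ⟨k, hk, hk₁, hk₂⟩
  · simp only [sub_add_cancel] at hk₂
    exact hP.no_horizontal_tee hi hj hk hi₁ hi₂ (by simp) hk₂ hk₁ (by simp) hj₁ hj₂ (by simp)
  · simp only [sub_add_cancel] at hk₂
    exact hP.no_vertical_tee hj hi hk hj₁ hj₂ (by simp) hk₂ hk₁ (by simp) hi₁ hi₂ (by simp)

theorem not_edge_of_sw_corner (hP : SimpleArc n P) (x y : ℤ) (hH : HEdge n P (x - 1, y))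
    (hV : VEdge n P (x, y - 1)) : ¬ HEdge n P (x, y) ∧ ¬ VEdge n P (x, y) := by
  constructor <;> intro h
  · obtain ⟨i, hi, hi₁, hi₂⟩ := h
    obtain ⟨j, hj, hj₁, hj₂⟩ := hV
    obtain ⟨k, hk, hk₁, hk₂⟩ := hH
    simp only [sub_add_cancel] at hk₂ hj₂
    exact hP.no_horizontal_tee hi hj hk hi₁ hi₂ (by simp) hk₂ hk₁ (by simp) hj₂ hj₁
      (sub_one_lt _).ne'
  · obtain ⟨i, hi, hi₁, hi₂⟩ := h
    obtain ⟨j, hj, hj₁, hj₂⟩ := hH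
    obtain ⟨k, hk, hk₁, hk₂⟩ := hV
    simp only [sub_add_cancel] at hk₂ hj₂
    exact hP.no_vertical_tee hi hj hk hi₁ hi₂ (by simp) hk₂ hk₁ (by simp) hj₂ hj₁
      (sub_one_lt _).ne'

theorem not_corner_start (hP : SimpleArc n P) : ¬ (HEdge n P (P 0) ∧ VEdge n P (P 0)) := by
  rintro ⟨⟨i, hi, hi₁, hi₂⟩, ⟨j, hj, hj₁, hj₂⟩⟩
  have := hP.corner hi hj hi₁ hi₂ (by simp) hj₁ hj₂ (by simp)
  have := hP.eq_zero_of_start_mem hi hi₁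
  have := hP.eq_zero_of_start_mem hj hj₁
  omega

theorem not_corner_end (hP : SimpleArc n P) :
    ¬ (HEdge n P ((P (n + 1)).1 - 1, (P (n + 1)).2) ∧
      VEdge n P ((P (n + 1)).1, (P (n + 1)).2 - 1)) := by
  rintro ⟨⟨i, hi, hi₁, hi₂⟩, ⟨j, hj, hj₁, hj₂⟩⟩
  simp only [sub_add_cancel] at hi₂ hj₂
  have := hP.corner hi hj hi₂ hi₁ (sub_one_lt _).ne' hj₂ hj₁ (sub_one_lt _).ne'
  have := hP.eq_of_end_mem hi hi₂
  have := hP.eq_of_end_mem hj hj₂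
  omega

/-- An arc whose endpoints are joined by a monotone path of its edges is monotone. -/
theorem monotone_of_neStep (hP : SimpleArc n P)
    (h : ReflTransGen (NEStep (HEdge n P) (VEdge n P)) (P 0) (P (n + 1))) :
    ∀ i ≤ n, (P i).1 ≤ (P (i + 1)).1 ∧ (P i).2 ≤ (P (i + 1)).2 := by
  have key : ∀ z, ReflTransGen (NEStep (HEdge n P) (VEdge n P)) (P 0) z → z = P 0 ∨
      ∃ i ≤ n, z ∈ segSet (P i) (P (i + 1)) ∧ z ≠ P i ∧
        ∀ j ≤ i, (P j).1 ≤ (P (j + 1)).1 ∧ (P j).2 ≤ (P (j + 1)).2 := by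
    intro z hz
    induction hz with
    | refl => exact .inl rfl
    | @tail z w _ hzw ih =>
      obtain ⟨j, hj, hzj, hwj, hle₁, hle₂, hlt⟩ : ∃ j ≤ n, z ∈ segSet (P j) (P (j + 1)) ∧
          w ∈ segSet (P j) (P (j + 1)) ∧ z.1 ≤ w.1 ∧ z.2 ≤ w.2 ∧ z.1 + z.2 < w.1 + w.2 := by
        rcases hzw with ⟨rfl, j, hj, h₁, h₂⟩ | ⟨rfl, j, hj, h₁, h₂⟩
        · exact ⟨j, hj, h₁, h₂, by simp, by simp, by simp⟩
        · exact ⟨j, hj, h₁, h₂, by simp, by simp, by simp⟩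
      right
      have hstart : z = P j → w ≠ P j ∧ (P j).1 ≤ (P (j + 1)).1 ∧ (P j).2 ≤ (P (j + 1)).2 := by
        rintro rfl
        refine ⟨?_, ?_⟩
        · intro h
          rw [h] at hlt
          omega
        · have := hP.axis j hj
          rw [mem_segSet] at hwj
          omega
      rcases ih with rfl | ⟨i, hi, hzi, hne, hmono⟩
      · obtain rfl := hP.eq_zero_of_start_mem hj hzj
        refine ⟨0, hj, hwj, (hstart rfl).1, fun k hk => ?_⟩
        obtain rfl : k = 0 := by omega
        exact (hstart rfl).2
      · rcases lt_trichotomy i j with hij | rfl | hij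
        · obtain ⟨rfl, hz⟩ := hP.eq_of_mem_of_lt hij hj hzi hzj
          refine ⟨i + 1, hj, hwj, (hstart hz).1, fun k hk => ?_⟩
          rcases hk.eq_or_lt with rfl | hk
          · exact (hstart hz).2
          · exact hmono k (by omega)
        · refine ⟨i, hi, hwj, ?_, hmono⟩
          rintro rfl
          have := hmono i le_rfl
          rw [mem_segSet] at hzi
          omega
        · exact absurd (hP.eq_of_mem_of_lt hij hi hzj hzi).2 hne
  rcases key _ h with h | ⟨i, hi, hi₁, -, hmono⟩
  · have h₀ : P 0 ∈ segSet (P n) (P (n + 1)) := h ▸ right_mem_segSet _ _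
    obtain rfl := hP.eq_zero_of_start_mem le_rfl h₀
    exact absurd h (hP.ne_succ le_rfl)
  · obtain rfl := hP.eq_of_end_mem hi hi₁
    exact hmono

end SimpleArc

/-- The points `Q` have the same start and the same segment directions as `P`, and
nonconsecutive segments are disjoint. -/
structure SameShape (n : ℕ) (P Q : ℕ → ℤ × ℤ) : Prop where
  start : Q 0 = P 0
  dir : ∀ i ≤ n, unitDir (Q i) (Q (i + 1)) = unitDir (P i) (P (i + 1))
  nonadj : ∀ i j, i + 1 < j → j ≤ n →
    segSet (Q i) (Q (i + 1)) ∩ segSet (Q j) (Q (j + 1)) = ∅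

open Classical in
/-- Lower the points outside `S` by `b`. -/
noncomputable def lowerOutside (S : Set (ℤ × ℤ)) (b : ℤ) (q : ℤ × ℤ) : ℤ × ℤ :=
  (q.1, if q ∈ S then q.2 else q.2 - b)

theorem lowerOutside_fst (S : Set (ℤ × ℤ)) (b : ℤ) (q : ℤ × ℤ) :
    (lowerOutside S b q).1 = q.1 :=
  rfl

theorem lowerOutside_lt {S : Set (ℤ × ℤ)} {b : ℤ} (hb : 0 ≤ b)
    (hup : ∀ x y, (x, y) ∈ S → (x, y + 1) ∈ S) {x y y' : ℤ} (h : y < y') :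
    (lowerOutside S b (x, y)).2 < (lowerOutside S b (x, y')).2 := by
  have hmem : (x, y) ∈ S → (x, y') ∈ S := by
    intro hy
    induction y', h.le using Int.leInduction with
    | base => exact hy
    | succ m hm ih =>
      rcases hm.eq_or_lt with rfl | hm
      · exact hup _ _ hy
      · exact hup _ _ (ih hm)
  simp only [lowerOutside]
  split_ifs with h₁ h₂
  · exact h
  · exact absurd (hmem h₁) h₂
  · omega
  · omega

theorem lowerOutside_horizontal {S : Set (ℤ × ℤ)} (b : ℤ) {n : ℕ} {P : ℕ → ℤ × ℤ}
    (hS : ∀ x y, HEdge n P (x, y) → ((x, y) ∈ S ↔ (x + 1, y) ∈ S)) {i : ℕ} (hi : i ≤ n)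
    {x x' y : ℤ} (hx : (x, y) ∈ segSet (P i) (P (i + 1)))
    (hx' : (x', y) ∈ segSet (P i) (P (i + 1))) :
    (lowerOutside S b (x, y)).2 = (lowerOutside S b (x', y)).2 := by
  wlog hle : x ≤ x' generalizing x x'
  · exact (this hx' hx (by omega)).symm
  have hmem : (x, y) ∈ S ↔ (x', y) ∈ S := by
    induction x', hle using Int.leInduction with
    | base => rfl
    | succ m hm ih =>
      have hm' : (m, y) ∈ segSet (P i) (P (i + 1)) := by
        rw [mem_segSet] at hx hx' ⊢
        simp only at *
        omega
      exact (ih hm').trans (hS _ _ ⟨i, hi, hm', hx'⟩)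
  by_cases h : (x, y) ∈ S
  · simp [lowerOutside, h, hmem.1 h]
  · simp [lowerOutside, h, mt hmem.2 h]

/-- If no path of up steps joins the endpoints of an arc, the arc can be reshaped so that it ends
`b` units lower. -/
theorem SimpleArc.exists_lower {n : ℕ} {P : ℕ → ℤ × ℤ} (hP : SimpleArc n P) {b : ℤ} (hb : 0 ≤ b)
    (h : ¬ ReflTransGen (UpStep (HEdge n P)) (P 0) (P (n + 1))) :
    ∃ Q, SameShape n P Q ∧ Q (n + 1) = ((P (n + 1)).1, (P (n + 1)).2 - b) := by
  set S : Set (ℤ × ℤ) := {q | ReflTransGen (UpStep (HEdge n P)) (P 0) q} with hSdef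
  have hup : ∀ x y, (x, y) ∈ S → (x, y + 1) ∈ S := fun x y hq =>
    ReflTransGen.tail hq (.inl rfl)
  have hside : ∀ x y, HEdge n P (x, y) → ((x, y) ∈ S ↔ (x + 1, y) ∈ S) := fun x y hE =>
    ⟨fun hq => ReflTransGen.tail hq (.inr (.inl ⟨rfl, hE⟩)),
      fun hq => ReflTransGen.tail hq (.inr (.inr ⟨rfl, hE⟩))⟩
  have hlt {x y y' : ℤ} : y < y' →
      (lowerOutside S b (x, y)).2 < (lowerOutside S b (x, y')).2 := lowerOutside_lt hb hup
  have hfst := lowerOutside_fst S b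
  have hhor : ∀ i ≤ n, (P (i + 1)).2 = (P i).2 →
      (lowerOutside S b (P (i + 1))).2 = (lowerOutside S b (P i)).2 := by
    intro i hi h
    have hr : ((P (i + 1)).1, (P i).2) ∈ segSet (P i) (P (i + 1)) := by
      rw [← h]
      exact right_mem_segSet _ _
    have := lowerOutside_horizontal b hside hi hr (left_mem_segSet _ _)
    rwa [← h, Prod.mk.eta, h, Prod.mk.eta] at this
  have hver : ∀ i, (P (i + 1)).1 = (P i).1 → (P i).2 < (P (i + 1)).2 →
      (lowerOutside S b (P i)).2 < (lowerOutside S b (P (i + 1))).2 := by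
    intro i h h'
    have := hlt (x := (P i).1) h'
    rwa [← h, Prod.mk.eta, h, Prod.mk.eta] at this
  have hver' : ∀ i, (P (i + 1)).1 = (P i).1 → (P (i + 1)).2 < (P i).2 →
      (lowerOutside S b (P (i + 1))).2 < (lowerOutside S b (P i)).2 := by
    intro i h h'
    have := hlt (x := (P i).1) h'
    rwa [← h, Prod.mk.eta, h, Prod.mk.eta] at this
  refine ⟨fun i => lowerOutside S b (P i), ⟨?_, ?_, ?_⟩, ?_⟩
  · have : P 0 ∈ S := .refl
    simp [lowerOutside, this]
  · intro i hi
    simp only [unitDir, hfst, Prod.mk.injEq, true_and]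
    rcases hP.axis i hi with ⟨h₁, h₂⟩ | ⟨h₁, h₂⟩
    · rcases lt_or_gt_of_ne h₂ with h₂ | h₂
      · rw [Int.sign_eq_neg_one_of_neg (sub_neg.2 h₂),
          Int.sign_eq_neg_one_of_neg (sub_neg.2 (hver' i h₁ h₂))]
      · rw [Int.sign_eq_one_of_pos (sub_pos.2 h₂),
          Int.sign_eq_one_of_pos (sub_pos.2 (hver i h₁ h₂))]
    · rw [h₁, hhor i hi h₁, sub_self, sub_self]
  · have hint : ∀ i ≤ n, ∀ r ∈ segSet (lowerOutside S b (P i)) (lowerOutside S b (P (i + 1))),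
        ∃ y₁ y₂, (r.1, y₁) ∈ segSet (P i) (P (i + 1)) ∧ (r.1, y₂) ∈ segSet (P i) (P (i + 1)) ∧
          y₁ ≤ y₂ ∧ (lowerOutside S b (r.1, y₁)).2 ≤ r.2 ∧
          r.2 ≤ (lowerOutside S b (r.1, y₂)).2 := by
      intro i hi r hr
      rw [mem_segSet, hfst, hfst] at hr
      rcases hP.axis i hi with ⟨h₁, h₂⟩ | ⟨h₁, h₂⟩
      · have hr₁ : r.1 = (P i).1 := by omega
        have hr₂ : r.1 = (P (i + 1)).1 := by omega
        rcases lt_or_gt_of_ne h₂ with h₂ | h₂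
        · have := hver' i h₁ h₂
          refine ⟨(P (i + 1)).2, (P i).2, ?_, ?_, h₂.le, ?_, ?_⟩
          · rw [hr₂]; exact right_mem_segSet _ _
          · rw [hr₁]; exact left_mem_segSet _ _
          · rw [hr₂, Prod.mk.eta]; omega
          · rw [hr₁, Prod.mk.eta]; omega
        · have := hver i h₁ h₂
          refine ⟨(P i).2, (P (i + 1)).2, ?_, ?_, h₂.le, ?_, ?_⟩
          · rw [hr₁]; exact left_mem_segSet _ _
          · rw [hr₂]; exact right_mem_segSet _ _
          · rw [hr₁, Prod.mk.eta]; omega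
          · rw [hr₂, Prod.mk.eta]; omega
      · have hm : (r.1, (P i).2) ∈ segSet (P i) (P (i + 1)) := by
          rw [mem_segSet]
          simp only
          omega
        have heq := lowerOutside_horizontal b hside hi hm (left_mem_segSet _ _)
        have := hhor i hi h₁
        rw [Prod.mk.eta] at heq
        exact ⟨_, _, hm, hm, le_rfl, by omega, by omega⟩
    intro i j hij hj
    rw [Set.eq_empty_iff_forall_notMem]
    rintro r ⟨hri, hrj⟩
    obtain ⟨α₁, α₂, hα₁, hα₂, hα, hα₁r, hα₂r⟩ := hint i (by omega) r hri
    obtain ⟨β₁, β₂, hβ₁, hβ₂, hβ, hβ₁r, hβ₂r⟩ := hint j hj r hrj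
    rcases lt_or_ge α₂ β₁ with h₁ | h₁
    · have := hlt (x := r.1) h₁
      omega
    rcases lt_or_ge β₂ α₁ with h₂ | h₂
    · have := hlt (x := r.1) h₂
      omega
    have hmem : (r.1, max α₁ β₁) ∈ segSet (P i) (P (i + 1)) ∩ segSet (P j) (P (j + 1)) := by
      refine ⟨?_, ?_⟩ <;> rw [mem_segSet] at * <;> simp only at * <;> omega
    rw [hP.nonadj i j hij hj] at hmem
    exact hmem
  · have : P (n + 1) ∉ S := h
    simp [lowerOutside, this]

/-- A symmetry of the grid of order at most two. -/
structure IsGridSymm (f : ℤ × ℤ → ℤ × ℤ) : Prop where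
  invol : ∀ q, f (f q) = q
  dir : ∀ u v, unitDir (f u) (f v) = f (unitDir u v)
  seg : ∀ u v q, q ∈ segSet (f u) (f v) ↔ f q ∈ segSet u v
  axis : ∀ u v : ℤ × ℤ, (v.1 = u.1 ∧ v.2 ≠ u.2) ∨ (v.2 = u.2 ∧ v.1 ≠ u.1) →
    ((f v).1 = (f u).1 ∧ (f v).2 ≠ (f u).2) ∨ ((f v).2 = (f u).2 ∧ (f v).1 ≠ (f u).1)

theorem isGridSymm_swap : IsGridSymm Prod.swap where
  invol _ := rfl
  dir _ _ := rfl
  seg u v q := by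
    simp only [mem_segSet, Prod.fst_swap, Prod.snd_swap]
    omega
  axis u v := Or.symm

theorem isGridSymm_reflect {s t : ℤ} (hs : s = 1 ∨ s = -1) (ht : t = 1 ∨ t = -1) :
    IsGridSymm fun q => (s * q.1, t * q.2) where
  invol q := by
    rcases hs with rfl | rfl <;> rcases ht with rfl | rfl <;> simp
  dir u v := by
    have hneg : ∀ x y : ℤ, (-x + y).sign = -(x - y).sign := fun x y => by
      rw [← Int.sign_neg, neg_sub, neg_add_eq_sub]
    rcases hs with rfl | rfl <;> rcases ht with rfl | rfl <;> simp [unitDir, hneg]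
  seg u v q := by
    rcases hs with rfl | rfl <;> rcases ht with rfl | rfl <;> simp only [mem_segSet] <;> omega
  axis u v h := by
    rcases hs with rfl | rfl <;> rcases ht with rfl | rfl <;> simp only <;> omega

theorem SimpleArc.map {n : ℕ} {P : ℕ → ℤ × ℤ} (hP : SimpleArc n P) {f : ℤ × ℤ → ℤ × ℤ}
    (hf : IsGridSymm f) : SimpleArc n fun i => f (P i) where
  axis i hi := hf.axis _ _ (hP.axis i hi)
  adj i hi := by
    ext q
    have := Set.ext_iff.1 (hP.adj i hi) (f q)
    simp only [Set.mem_inter_iff, hf.seg, Set.mem_singleton_iff] at this ⊢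
    rw [this]
    exact ⟨fun h => by rw [← h, hf.invol], fun h => by rw [h, hf.invol]⟩
  nonadj i j hij hj := by
    ext q
    have := Set.ext_iff.1 (hP.nonadj i j hij hj) (f q)
    simpa only [Set.mem_inter_iff, hf.seg, Set.mem_empty_iff_false] using this

theorem SameShape.map {n : ℕ} {P Q : ℕ → ℤ × ℤ} {f : ℤ × ℤ → ℤ × ℤ} (hf : IsGridSymm f)
    (h : SameShape n (fun i => f (P i)) Q) : SameShape n P fun i => f (Q i) where
  start := by rw [h.start, hf.invol]
  dir i hi := by rw [hf.dir, h.dir i hi, hf.dir, hf.invol]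
  nonadj i j hij hj := by
    ext q
    have := Set.ext_iff.1 (h.nonadj i j hij hj) (f q)
    simpa only [Set.mem_inter_iff, hf.seg, Set.mem_empty_iff_false] using this

/-- A simple arc ending in the closed first quadrant can be reshaped so that its endpoint drops to
one of the axes, unless the arc is monotone. -/
theorem SimpleArc.lower_or_monotone {n : ℕ} {P : ℕ → ℤ × ℤ} (hP : SimpleArc n P)
    (h₁ : 0 ≤ (P (n + 1)).1) (h₂ : 0 ≤ (P (n + 1)).2) :
    (∃ Q, SameShape n P Q ∧ Q (n + 1) = (0, (P (n + 1)).2)) ∨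
      (∃ Q, SameShape n P Q ∧ Q (n + 1) = ((P (n + 1)).1, 0)) ∨
      ∀ i ≤ n, (P i).1 ≤ (P (i + 1)).1 ∧ (P i).2 ≤ (P (i + 1)).2 := by
  by_cases hY : ReflTransGen (UpStep (HEdge n P)) (P 0) (P (n + 1))
  · by_cases hX : ReflTransGen (UpStep (HEdge n fun i => (P i).swap)) (P 0).swap (P (n + 1)).swap
    · have hX' : ReflTransGen (RightStep (VEdge n P)) (P 0) (P (n + 1)) := by
        have hE : (fun q => HEdge n (fun i => (P i).swap) q.swap) = VEdge n P := by
          ext q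
          simp only [VEdge, HEdge, isGridSymm_swap.seg]
          rfl
        have := RightStep.swap hX
        rwa [hE, Prod.swap_swap, Prod.swap_swap] at this
      exact .inr (.inr (hP.monotone_of_neStep (reflTransGen_neStep hP.not_edge_of_ne_corner
        hP.not_edge_of_sw_corner hX' hY hP.not_corner_start hP.not_corner_end)))
    · obtain ⟨Q, hQ, hQe⟩ := (hP.map isGridSymm_swap).exists_lower (b := (P (n + 1)).1) h₁ hX
      exact .inl ⟨_, hQ.map isGridSymm_swap, by simp [hQe]⟩
  · obtain ⟨Q, hQ, hQe⟩ := hP.exists_lower h₂ hY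
    exact .inr (.inl ⟨Q, hQ, by simp [hQe]⟩)

/-- A simple arc can be reshaped so that its endpoint moves onto one of the axes, unless all its
segments point into a common quadrant. -/
theorem SimpleArc.exists_sameShape_or_monotone {n : ℕ} {P : ℕ → ℤ × ℤ} (hP : SimpleArc n P) :
    (∃ Q, SameShape n P Q ∧ Q (n + 1) = (0, (P (n + 1)).2)) ∨
      (∃ Q, SameShape n P Q ∧ Q (n + 1) = ((P (n + 1)).1, 0)) ∨
      ∃ s t : ℤ, s ≠ 0 ∧ t ≠ 0 ∧ ∀ i ≤ n,
        0 ≤ s * (unitDir (P i) (P (i + 1))).1 ∧ 0 ≤ t * (unitDir (P i) (P (i + 1))).2 := by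
  have hsgn : ∀ x : ℤ, ∃ s : ℤ, (s = 1 ∨ s = -1) ∧ 0 ≤ s * x := fun x => by
    rcases le_total 0 x with h | h
    · exact ⟨1, .inl rfl, by omega⟩
    · exact ⟨-1, .inr rfl, by omega⟩
  obtain ⟨s, hs, hs'⟩ := hsgn (P (n + 1)).1
  obtain ⟨t, ht, ht'⟩ := hsgn (P (n + 1)).2
  have hf := isGridSymm_reflect hs ht
  rcases (hP.map hf).lower_or_monotone hs' ht' with
    ⟨Q, hQ, hQe⟩ | ⟨Q, hQ, hQe⟩ | h
  · refine .inl ⟨_, hQ.map hf, ?_⟩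
    have : t * (t * (P (n + 1)).2) = (P (n + 1)).2 := congrArg Prod.snd (hf.invol _)
    simp [hQe, this]
  · refine .inr (.inl ⟨_, hQ.map hf, ?_⟩)
    have : s * (s * (P (n + 1)).1) = (P (n + 1)).1 := congrArg Prod.fst (hf.invol _)
    simp [hQe, this]
  · refine .inr (.inr ⟨s, t, by omega, by omega, fun i hi => ?_⟩)
    have hdir := hf.dir (P i) (P (i + 1))
    have hi' := h i hi
    have h₁ := congrArg Prod.fst hdir
    have h₂ := congrArg Prod.snd hdir
    simp only at h₁ h₂
    rw [← h₁, ← h₂]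
    exact ⟨Int.sign_nonneg_iff.2 (sub_nonneg.2 hi'.1), Int.sign_nonneg_iff.2 (sub_nonneg.2 hi'.2)⟩

theorem Chain.simpleArc {σ : List Turn} (C : Chain σ) : SimpleArc σ.length C.pts :=
  ⟨C.axis_parallel, C.simple_adj, C.simple_nonadj⟩

theorem axis_iff_of_unitDir_eq {u v u' v' : ℤ × ℤ} (h : unitDir u' v' = unitDir u v) :
    (v'.1 = u'.1 ↔ v.1 = u.1) ∧ (v'.2 = u'.2 ↔ v.2 = u.2) := by
  have key {x y x' y' : ℤ} (h : (y' - x').sign = (y - x).sign) : y' = x' ↔ y = x := by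
    rw [← sub_eq_zero, ← Int.sign_eq_zero_iff_zero, h, Int.sign_eq_zero_iff_zero, sub_eq_zero]
  exact ⟨key (congrArg Prod.fst h), key (congrArg Prod.snd h)⟩

theorem Chain.perpendicular {σ : List Turn} (C : Chain σ) {i : ℕ} (hi : i + 1 ≤ σ.length) :
    ((C.pts (i + 1)).1 = (C.pts i).1 ∧ (C.pts (i + 2)).2 = (C.pts (i + 1)).2) ∨
      ((C.pts (i + 1)).2 = (C.pts i).2 ∧ (C.pts (i + 2)).1 = (C.pts (i + 1)).1) := by
  have ht := C.turns i hi
  have h₁ := congrArg Prod.fst ht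
  have h₂ := congrArg Prod.snd ht
  rcases C.axis_parallel i (by omega) with ⟨h, -⟩ | ⟨h, -⟩
  · refine .inl ⟨h, ?_⟩
    have : ((C.pts (i + 2)).2 - (C.pts (i + 1)).2).sign = 0 := by
      split_ifs at h₂ <;> simpa [unitDir, rotCCW, rotCW, h] using h₂
    rw [Int.sign_eq_zero_iff_zero] at this
    omega
  · refine .inr ⟨h, ?_⟩
    have : ((C.pts (i + 2)).1 - (C.pts (i + 1)).1).sign = 0 := by
      split_ifs at h₁ <;> simpa [unitDir, rotCCW, rotCW, h] using h₁
    rw [Int.sign_eq_zero_iff_zero] at this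
    omega

/-- A point sequence of the same shape as a chain realizes the same turn sequence. -/
theorem SameShape.mem_reachSet {σ : List Turn} (C : Chain σ) {Q : ℕ → ℤ × ℤ}
    (hQ : SameShape σ.length C.pts Q) : Q (σ.length + 1) ∈ ReachSet σ := by
  refine ⟨⟨Q, hQ.start.trans C.start_eq, ?_, ?_, ?_, ?_, hQ.nonadj⟩, rfl⟩
  · obtain ⟨t, ht, ht'⟩ := C.first_seg
    have h₀ := hQ.dir 0 (Nat.zero_le _)
    rw [hQ.start, zero_add, ht', C.start_eq] at h₀
    have h₁ : ((Q 1).1 - 0).sign = (t - 0).sign := congrArg Prod.fst h₀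
    rw [sub_zero, sub_zero, Int.sign_eq_one_of_pos ht, Int.sign_eq_one_iff_pos] at h₁
    have h₂ : (Q 1).2 = 0 ↔ _ := (axis_iff_of_unitDir_eq h₀).2
    exact ⟨_, h₁, Prod.ext rfl (h₂.2 rfl)⟩
  · intro i hi
    obtain ⟨h₁, h₂⟩ := axis_iff_of_unitDir_eq (hQ.dir i hi)
    rw [ne_eq, ne_eq, h₁, h₂]
    exact C.axis_parallel i hi
  · intro i hi
    rw [hQ.dir i hi.le, hQ.dir (i + 1) hi]
    exact C.turns i hi
  · intro i hi
    obtain ⟨h₁, h₂⟩ := axis_iff_of_unitDir_eq (hQ.dir i (by omega))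
    obtain ⟨h₃, h₄⟩ := axis_iff_of_unitDir_eq (hQ.dir (i + 1) hi)
    have hperp := C.perpendicular hi
    rw [← h₁, ← h₂, ← h₃, ← h₄] at hperp
    change (_ ∧ (Q (i + 2)).2 = _) ∨ (_ ∧ (Q (i + 2)).1 = _) at hperp
    ext q
    rw [Set.mem_inter_iff, Set.mem_singleton_iff, mem_segSet, mem_segSet, Prod.ext_iff]
    omega

/-- **Axis Lemma.** If `σ` is not a staircase and `(a, b)` is reachable by `σ`,
then `(0, b)` or `(a, 0)` is reachable by `σ`. -/
theorem axis_lemma (σ : List Turn) (hns : ¬ IsStaircase σ)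
    (a b : ℤ) (hab : (a, b) ∈ ReachSet σ) :
    ((0 : ℤ), b) ∈ ReachSet σ ∨ (a, (0 : ℤ)) ∈ ReachSet σ := by
  obtain ⟨C, hC⟩ := hab
  rcases C.simpleArc.exists_sameShape_or_monotone with
    ⟨Q, hQ, hQe⟩ | ⟨Q, hQ, hQe⟩ | ⟨s, t, hs, ht, hmono⟩
  · rw [hC] at hQe
    exact .inl (hQe ▸ hQ.mem_reachSet)
  · rw [hC] at hQe
    exact .inr (hQe ▸ hQ.mem_reachSet)
  · refine absurd (List.isChain_iff_getElem.2 fun i hi heq => ?_) hns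
    have hd := hmono i (by omega)
    have hd' := hmono (i + 2) (by omega)
    have hrev : unitDir (C.pts (i + 2)) (C.pts (i + 3)) = -unitDir (C.pts i) (C.pts (i + 1)) := by
      have h₁ := C.turns i (by omega)
      have h₂ := C.turns (i + 1) hi
      simp only [List.get_eq_getElem] at h₁ h₂
      simp only [h₁, ← heq] at h₂
      rw [h₂]
      split_ifs <;> simp [rotCCW, rotCW, Prod.ext_iff]
    rw [hrev] at hd'
    simp only [Prod.fst_neg, Prod.snd_neg, mul_neg, neg_nonneg] at hd'
    have h₁ : (unitDir (C.pts i) (C.pts (i + 1))).1 = 0 :=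
      (mul_eq_zero.1 (le_antisymm hd'.1 hd.1)).resolve_left hs
    have h₂ : (unitDir (C.pts i) (C.pts (i + 1))).2 = 0 :=
      (mul_eq_zero.1 (le_antisymm hd'.2 hd.2)).resolve_left ht
    have := C.axis_parallel i (by omega)
    rw [unitDir, Int.sign_eq_zero_iff_zero] at h₁ h₂
    omega
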